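/- arXiv:2504.06253 — 2 statements merged into one kernel-verified Lean document; each statement's English description precedes it below -/
import Mathlib

section
/- Let n ≥ 1 and let Q ∈ ℝ^{n×n} be symmetric. Define the symmetric matrix A ∈ ℝ^{(n+1)×(n+1)} by A_{i,j} = −Q_{i,j} for 0 ≤ i,j < n, A_{n,i} = A_{i,n} = ∑_{0≤j<n} Q_{i,j} for 0 ≤ i < n, and A_{n,n} = 0. Then min_{x ∈ {0,1}^n} xᵀQx = min_{y ∈ {-1,1}^{n+1}} yᵀ(−A/4)y + (1/4)·sum(Q). -/
/-- The real number (0 or 1) encoded by a boolean binary variable. -/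
def bitR (b : Bool) : ℝ := if b then 1 else 0

/-- The real spin (+1 or -1) encoded by a boolean spin variable. -/
def spinR (b : Bool) : ℝ := if b then 1 else -1

theorem bitR_xor (a b : Bool) : bitR (xor a b) = (1 - spinR a * spinR b) / 2 := by
  cases a <;> cases b <;> norm_num [bitR, spinR]

theorem spinR_mul_self (a : Bool) : spinR a * spinR a = 1 := by
  cases a <;> norm_num [spinR]

/-- The QUBO form at `(1 - t s) / 2` in terms of the spins `s` and a reference spin `t`. -/
theorem qubo_eq_ising {ι : Type*} [Fintype ι] (Q : Matrix ι ι ℝ) (hQ : Q.IsSymm)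
    (s : ι → ℝ) (t : ℝ) (ht : t * t = 1) :
    ∑ i, ∑ j, (1 - s i * t) / 2 * Q i j * ((1 - s j * t) / 2) =
      ∑ i, ((∑ j, s i * (Q i j / 4) * s j) + s i * (-(∑ j, Q i j) / 4) * t) +
        ∑ i, t * (-(∑ j, Q i j) / 4) * s i + (1 / 4) * ∑ i, ∑ j, Q i j := by
  have hswap : ∑ i, ∑ j, Q i j * s j * t / 4 = ∑ i, ∑ j, Q i j * s i * t / 4 := by
    rw [Finset.sum_comm]
    simp only [hQ.apply]
  calc
    _ = ∑ i, ∑ j, (s i * (Q i j / 4) * s j - Q i j * s i * t / 4 + 1 / 4 * Q i j)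
          - ∑ i, ∑ j, Q i j * s j * t / 4 := by
      simp only [← Finset.sum_sub_distrib]
      refine Finset.sum_congr rfl fun i _ => Finset.sum_congr rfl fun j _ => ?_
      linear_combination (s i * s j * Q i j / 4) * ht
    _ = _ := by
      rw [hswap, Finset.mul_sum, ← Finset.sum_add_distrib, ← Finset.sum_add_distrib,
        ← Finset.sum_sub_distrib]
      refine Finset.sum_congr rfl fun i _ => ?_
      have h : ∑ j, Q i j * s i * t / 4 = (∑ j, Q i j) * (s i * t / 4) := by
        rw [Finset.sum_mul]
        exact Finset.sum_congr rfl fun j _ => by ring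
      rw [Finset.sum_add_distrib, Finset.sum_sub_distrib, h, ← Finset.mul_sum]
      ring

theorem inf'_univ_eq_add_of_surjective {α β : Type*} [Fintype α] [Nonempty α] [Fintype β]
    [Nonempty β] (f : α → ℝ) (g : β → ℝ) (c : ℝ) (σ : β → α) (hσ : Function.Surjective σ)
    (h : ∀ b, f (σ b) = g b + c) :
    Finset.univ.inf' Finset.univ_nonempty f = Finset.univ.inf' Finset.univ_nonempty g + c := by
  apply le_antisymm
  · obtain ⟨b, -, hb⟩ := Finset.exists_mem_eq_inf' Finset.univ_nonempty g
    rw [hb, ← h b]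
    exact Finset.inf'_le f (Finset.mem_univ _)
  · refine Finset.le_inf' _ _ fun a _ => ?_
    obtain ⟨b, rfl⟩ := hσ a
    rw [h b]
    gcongr
    exact Finset.inf'_le g (Finset.mem_univ _)

/-- The minimal QUBO value of `Q` over `{0,1}^n` equals the minimal
Ising value of `-A/4` over `{-1,1}^(n+1)` plus `sum(Q)/4`, where `A` is the
adjacency matrix of the corresponding graph of `Q`. -/
theorem stmt_9 (n : ℕ) (hn : 1 ≤ n) (Q : Matrix (Fin n) (Fin n) ℝ) (hQ : Q.IsSymm)
    (A : Matrix (Fin (n + 1)) (Fin (n + 1)) ℝ)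
    (hA₁ : ∀ i j : Fin n, A i.castSucc j.castSucc = -Q i j)
    (hA₂ : ∀ i : Fin n, A (Fin.last n) i.castSucc = ∑ j, Q i j)
    (hA₃ : ∀ i : Fin n, A i.castSucc (Fin.last n) = ∑ j, Q i j)
    (hA₄ : A (Fin.last n) (Fin.last n) = 0) :
    Finset.univ.inf' Finset.univ_nonempty
        (fun x : Fin n → Bool => ∑ i, ∑ j, bitR (x i) * Q i j * bitR (x j)) =
      Finset.univ.inf' Finset.univ_nonempty
          (fun y : Fin (n + 1) → Bool =>
            ∑ i, ∑ j, spinR (y i) * (-(A i j) / 4) * spinR (y j)) +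
        (1 / 4) * ∑ i, ∑ j, Q i j := by
  refine inf'_univ_eq_add_of_surjective _ _ _
    (fun y i => xor (y i.castSucc) (y (Fin.last n))) (fun x => ?_) fun y => ?_
  · exact ⟨Fin.snoc (α := fun _ => Bool) x false, by simp⟩
  · simp only [bitR_xor, Fin.sum_univ_castSucc, hA₁, hA₂, hA₃, hA₄, neg_neg, neg_zero, zero_div,
      mul_zero, zero_mul, add_zero]
    exact qubo_eq_ising Q hQ (fun i => spinR (y i.castSucc)) _ (spinR_mul_self _)
end

section
/- Let n ≥ 1 and let Q ∈ ℝ^{n×n} be symmetric, with corresponding matrix A ∈ ℝ^{(n+1)×(n+1)} defined by A_{i,j} = −Q_{i,j} for 0 ≤ i,j < n, A_{n,i} = A_{i,n} = ∑_{0≤j<n} Q_{i,j} for 0 ≤ i < n, and A_{n,n} = 0. Suppose the QUBO objective is nonconstant, i.e., max_{x ∈ {0,1}^n} xᵀQx > min_{x ∈ {0,1}^n} xᵀQx. For y ∈ {-1,1}^{n+1} with corresponding x ∈ {0,1}^n given by x_i = (1 − y_i y_n)/2, define α^Q(x) = (xᵀQx − min_{x'} x'ᵀQx')/(max_{x'}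 x'ᵀQx' − min_{x'} x'ᵀQx') and α^M(y) = (yᵀ(−A/4)y − min_{y'} y'ᵀ(−A/4)y')/(max_{y'} y'ᵀ(−A/4)y' − min_{y'} y'ᵀ(−A/4)y'). Then α^Q(x) = α^M(y). -/
/-- The Ising objective of `-A/4` is the QUBO objective of `Q` shifted by a constant. -/
lemma ising_eq_qubo_sub {n : ℕ} {Q : Matrix (Fin n) (Fin n) ℝ} (hQ : Q.IsSymm)
    {A : Matrix (Fin (n + 1)) (Fin (n + 1)) ℝ}
    (hA₁ : ∀ i j : Fin n, A i.castSucc j.castSucc = -Q i j)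
    (hA₂ : ∀ i : Fin n, A (Fin.last n) i.castSucc = ∑ j, Q i j)
    (hA₃ : ∀ i : Fin n, A i.castSucc (Fin.last n) = ∑ j, Q i j)
    (hA₄ : A (Fin.last n) (Fin.last n) = 0)
    {y : Fin (n + 1) → ℝ} (hy : y (Fin.last n) ^ 2 = 1)
    {x : Fin n → ℝ} (hx : ∀ i, x i = (1 - y i.castSucc * y (Fin.last n)) / 2) :
    ∑ i, ∑ j, y i * (-(A i j) / 4) * y j =
      (∑ i, ∑ j, x i * Q i j * x j) - (∑ i, ∑ j, Q i j) / 4 := by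
  have hcol : ∑ i : Fin n, y (Fin.last n) * (-(∑ j, Q i j) / 4) * y i.castSucc =
      ∑ i : Fin n, ∑ j : Fin n, y (Fin.last n) * (-(Q i j) / 4) * y j.castSucc := by
    rw [Finset.sum_comm]
    refine Finset.sum_congr rfl fun i _ => ?_
    rw [← Finset.sum_mul, ← Finset.mul_sum, ← Finset.sum_div, Finset.sum_neg_distrib]
    simp_rw [hQ.apply]
  have hrow : ∑ i : Fin n, y i.castSucc * (-(∑ j, Q i j) / 4) * y (Fin.last n) =
      ∑ i : Fin n, ∑ j : Fin n, y i.castSucc * (-(Q i j) / 4) * y (Fin.last n) := by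
    refine Finset.sum_congr rfl fun i _ => ?_
    rw [← Finset.sum_mul, ← Finset.mul_sum, ← Finset.sum_div, Finset.sum_neg_distrib]
  simp only [Fin.sum_univ_castSucc, hA₁, hA₂, hA₃, hA₄, Finset.sum_add_distrib]
  rw [hcol, hrow]
  simp only [neg_zero, zero_div, mul_zero, zero_mul, add_zero, Finset.sum_div,
    ← Finset.sum_add_distrib, ← Finset.sum_sub_distrib]
  refine Finset.sum_congr rfl fun i _ => Finset.sum_congr rfl fun j _ => ?_
  rw [hx, hx]
  linear_combination (-(y i.castSucc * y j.castSucc * Q i j) / 4) * hy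

lemma sup'_univ_eq_sub_of_surjective {α β : Type*} [Fintype α] [Fintype β] [Nonempty α]
    [Nonempty β] {f : α → ℝ} {g : β → ℝ} {φ : β → α} {c : ℝ} (hφ : Function.Surjective φ)
    (h : ∀ b, g b = f (φ b) - c) :
    Finset.univ.sup' Finset.univ_nonempty g = Finset.univ.sup' Finset.univ_nonempty f - c := by
  apply le_antisymm
  · refine Finset.sup'_le _ _ fun b _ => ?_
    rw [h]
    exact sub_le_sub_right (Finset.le_sup' f (Finset.mem_univ _)) c
  · rw [sub_le_iff_le_add]
    refine Finset.sup'_le _ _ fun a _ => ?_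
    obtain ⟨b, rfl⟩ := hφ a
    rw [← sub_le_iff_le_add, ← h]
    exact Finset.le_sup' g (Finset.mem_univ _)

lemma inf'_univ_eq_sub_of_surjective {α β : Type*} [Fintype α] [Fintype β] [Nonempty α]
    [Nonempty β] {f : α → ℝ} {g : β → ℝ} {φ : β → α} {c : ℝ} (hφ : Function.Surjective φ)
    (h : ∀ b, g b = f (φ b) - c) :
    Finset.univ.inf' Finset.univ_nonempty g = Finset.univ.inf' Finset.univ_nonempty f - c := by
  apply le_antisymm
  · rw [le_sub_iff_add_le]
    refine Finset.le_inf' _ _ fun a _ => ?_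
    obtain ⟨b, rfl⟩ := hφ a
    rw [← le_sub_iff_add_le, ← h]
    exact Finset.inf'_le g (Finset.mem_univ _)
  · refine Finset.le_inf' _ _ fun b _ => ?_
    rw [h]
    exact sub_le_sub_right (Finset.inf'_le f (Finset.mem_univ _)) c

/-- The boolean form of the map `x i = (1 - y i * y n) / 2`. -/
def spinToBits {n : ℕ} (y : Fin (n + 1) → Bool) (i : Fin n) : Bool :=
  xor (y i.castSucc) (y (Fin.last n))

lemma spinToBits_surjective (n : ℕ) : Function.Surjective (spinToBits (n := n)) := fun x =>
  ⟨Fin.snoc (α := fun _ => Bool) x false, by ext i; simp [spinToBits]⟩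

lemma bitR_spinToBits {n : ℕ} (y : Fin (n + 1) → Bool) (i : Fin n) :
    bitR (spinToBits y i) = (1 - spinR (y i.castSucc) * spinR (y (Fin.last n))) / 2 := by
  unfold spinToBits
  cases y i.castSucc <;> cases y (Fin.last n) <;> norm_num [bitR, spinR]

lemma spinR_sq (b : Bool) : spinR b ^ 2 = 1 := by
  cases b <;> norm_num [spinR]

/-- Provided the QUBO objective is nonconstant on `{0,1}^n`, the
instance-specific approximation ratio of `x` for the QUBO `Q` equals the
instance-specific approximation ratio of `y` for the Max-Cut/Ising problem `-A/4`,
where `x i = (1 - y i * y n)/2`. -/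
theorem stmt_11 (n : ℕ) (hn : 1 ≤ n) (Q : Matrix (Fin n) (Fin n) ℝ) (hQ : Q.IsSymm)
    (A : Matrix (Fin (n + 1)) (Fin (n + 1)) ℝ)
    (hA₁ : ∀ i j : Fin n, A i.castSucc j.castSucc = -Q i j)
    (hA₂ : ∀ i : Fin n, A (Fin.last n) i.castSucc = ∑ j, Q i j)
    (hA₃ : ∀ i : Fin n, A i.castSucc (Fin.last n) = ∑ j, Q i j)
    (hA₄ : A (Fin.last n) (Fin.last n) = 0)
    (maxQ minQ maxM minM : ℝ)
    (hmaxQ : maxQ = Finset.univ.sup' Finset.univ_nonempty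
      (fun x' : Fin n → Bool => ∑ i, ∑ j, bitR (x' i) * Q i j * bitR (x' j)))
    (hminQ : minQ = Finset.univ.inf' Finset.univ_nonempty
      (fun x' : Fin n → Bool => ∑ i, ∑ j, bitR (x' i) * Q i j * bitR (x' j)))
    (hmaxM : maxM = Finset.univ.sup' Finset.univ_nonempty
      (fun y' : Fin (n + 1) → Bool => ∑ i, ∑ j, spinR (y' i) * (-(A i j) / 4) * spinR (y' j)))
    (hminM : minM = Finset.univ.inf' Finset.univ_nonempty
      (fun y' : Fin (n + 1) → Bool => ∑ i, ∑ j, spinR (y' i) * (-(A i j) / 4) * spinR (y' j)))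
    (hnonconst : minQ < maxQ)
    (y : Fin (n + 1) → ℝ) (hy : ∀ i, y i = -1 ∨ y i = 1)
    (x : Fin n → ℝ) (hx : ∀ i, x i = (1 - y i.castSucc * y (Fin.last n)) / 2) :
    ((∑ i, ∑ j, x i * Q i j * x j) - minQ) / (maxQ - minQ) =
      ((∑ i, ∑ j, y i * (-(A i j) / 4) * y j) - minM) / (maxM - minM) := by
  have hshift (y' : Fin (n + 1) → Bool) :
      ∑ i, ∑ j, spinR (y' i) * (-(A i j) / 4) * spinR (y' j) =
        (∑ i, ∑ j, bitR (spinToBits y' i) * Q i j * bitR (spinToBits y' j)) -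
          (∑ i, ∑ j, Q i j) / 4 :=
    ising_eq_qubo_sub (y := fun i => spinR (y' i)) hQ hA₁ hA₂ hA₃ hA₄ (spinR_sq _)
      (bitR_spinToBits y')
  have hmax : maxM = maxQ - (∑ i, ∑ j, Q i j) / 4 := by
    rw [hmaxM, hmaxQ]
    exact sup'_univ_eq_sub_of_surjective (spinToBits_surjective n) hshift
  have hmin : minM = minQ - (∑ i, ∑ j, Q i j) / 4 := by
    rw [hminM, hminQ]
    exact inf'_univ_eq_sub_of_surjective (spinToBits_surjective n) hshift
  rw [ising_eq_qubo_sub hQ hA₁ hA₂ hA₃ hA₄ (by simpa [or_comm] using hy (Fin.last n)) hx, hmax, hmin,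
    sub_sub_sub_cancel_right, sub_sub_sub_cancel_right]
end
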